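/- arXiv:2111.07721 — 2 statements merged into one kernel-verified Lean document; each statement's English description precedes it below -/
import Mathlib

section
/- Let k be an algebraically closed field of characteristic zero, τ ≥ 1 an integer, and R = k[X]/(X^τ). Let 𝒩 ⊆ R^{10} ≅ 𝔸^{10τ} be the Zariski-closed subset of tuples (ω₁,...,ω₁₀) ∈ R^{10} such that the five 4×4 Pfaffians of the 5×5 skew-symmetric matrix with above-diagonal entries m₁₂=ω₁, m₁₃=ω₂, m₁₄=ω₃, m₁₅=ω₄, m₂₃=ω₅, m₂₄=ω₆, m₂₅=ω₇, m₃₄=ω₈, m₃₅=ω₉, m₄₅=ω₁₀ all vanish in R. Then 𝒩 has dimension 7τ, and consequently the quadratic quasi-cone 𝒬 = 𝔸^{τ+8} × 𝒩 has dimension 8τ + 8. -/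
/-- Generic polynomials `ω₁,…,ω₁₀` of degree `< τ` whose coefficients are the indeterminates
`X_{(i,j)}` (embedded via `emb` into a larger variable set): `ωᵢ = Σ_{j<τ} X_{(i,j)} X^j`.
They represent generic elements of `R = k[X]/(X^τ)`. -/
noncomputable def genericOmega (k : Type*) [CommRing k] (τ : ℕ) {σ : Type*}
    (emb : Fin 10 × Fin τ → σ) : Fin 10 → Polynomial (MvPolynomial σ k) :=
  fun i => ∑ j : Fin τ,
    Polynomial.C (MvPolynomial.X (emb (i, j))) * Polynomial.X ^ (j : ℕ)

/-- The five `4×4` Pfaffians of the `5×5` skew-symmetric matrix with above-diagonal entries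
`m₁₂=ω₁, m₁₃=ω₂, m₁₄=ω₃, m₁₅=ω₄, m₂₃=ω₅, m₂₄=ω₆, m₂₅=ω₇, m₃₄=ω₈, m₃₅=ω₉, m₄₅=ω₁₀`
(obtained by deleting the `i`-th row and column, `i = 1,…,5`), applied to the generic
`ω`'s above. -/
noncomputable def genericPfaffians (k : Type*) [CommRing k] (τ : ℕ) {σ : Type*}
    (emb : Fin 10 × Fin τ → σ) : Fin 5 → Polynomial (MvPolynomial σ k) :=
  let ω := genericOmega k τ emb
  ![ω 4 * ω 9 - ω 5 * ω 8 + ω 6 * ω 7,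
    ω 1 * ω 9 - ω 2 * ω 8 + ω 3 * ω 7,
    ω 0 * ω 9 - ω 2 * ω 6 + ω 3 * ω 5,
    ω 0 * ω 8 - ω 1 * ω 6 + ω 3 * ω 4,
    ω 0 * ω 7 - ω 1 * ω 5 + ω 2 * ω 4]

/-- The ideal of the polynomial ring in the coefficient variables cutting out the locus `𝒩`
where all five Pfaffians vanish in `R = k[X]/(X^τ)`: it is generated by the coefficients of
`X^d`, `d < τ`, of the five Pfaffians. -/
noncomputable def pfaffianLocusIdeal (k : Type*) [CommRing k] (τ : ℕ) {σ : Type*}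
    (emb : Fin 10 × Fin τ → σ) : Ideal (MvPolynomial σ k) :=
  Ideal.span {q | ∃ i : Fin 5, ∃ d : ℕ, d < τ ∧ q = (genericPfaffians k τ emb i).coeff d}


/-! ### Krull dimension of finitely generated domains over a field -/

/-- Krull dimension is preserved by injective integral extensions. -/
lemma aux_ringKrullDim_integral (R S : Type*) [CommRing R] [CommRing S] [Algebra R S]
    [Algebra.IsIntegral R S] (hinj : Function.Injective (algebraMap R S)) :
    ringKrullDim S = ringKrullDim R := by
  apply le_antisymm
  · refine Order.krullDim_le_of_strictMono (PrimeSpectrum.comap (algebraMap R S)) ?_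
    intro P Q hPQ
    obtain ⟨hle, x, hxQ, hxP⟩ := SetLike.lt_iff_le_and_exists.mp
      (show P.asIdeal < Q.asIdeal from hPQ)
    exact Ideal.comap_lt_comap_of_integral_mem_sdiff (R := R) hle ⟨hxQ, hxP⟩
      (Algebra.IsIntegral.isIntegral x)
  · refine iSup_le fun l => ?_
    obtain ⟨P, -, hP, hPl⟩ := Ideal.exists_ideal_over_prime_of_isIntegral (S := S)
      (RelSeries.head l).asIdeal ⊥ (by
        rw [← RingHom.ker_eq_comap_bot, (RingHom.injective_iff_ker_eq_bot _).mp hinj]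
        exact bot_le)
    have : P.LiesOver (RelSeries.head l).asIdeal := ⟨hPl.symm⟩
    obtain ⟨L, hL, -⟩ := Ideal.exists_ltSeries_of_hasGoingUp l P
    rw [← hL]
    exact le_iSup (fun l : LTSeries (PrimeSpectrum S) => (l.length : WithBot ℕ∞)) L

/-- A finitely generated domain over a field has dimension its transcendence degree. -/
lemma aux_dim_eq_trdeg (k B : Type*) [Field k] [CommRing B] [IsDomain B] [Algebra k B]
    [Algebra.FiniteType k B] :
    ∃ s : ℕ, Algebra.trdeg k B = s ∧ ringKrullDim B = s := by
  obtain ⟨s, g, hg, hint⟩ := exists_integral_inj_algHom_of_fg k B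
  refine ⟨s, ?_, ?_⟩
  · have h1 : AlgebraicIndependent k (fun i : Fin s => g (MvPolynomial.X i)) := by
      rw [algebraicIndependent_iff_injective_aeval]
      have : MvPolynomial.aeval (fun i : Fin s => g (MvPolynomial.X i)) = g := by
        ext i; simp
      rw [this]; exact hg
    have h2 : IsTranscendenceBasis k (fun i : Fin s => g (MvPolynomial.X i)) := by
      rw [h1.isTranscendenceBasis_iff_isAlgebraic]
      have hr : (Algebra.adjoin k (Set.range fun i : Fin s => g (MvPolynomial.X i)))
          = g.range := by
        rw [Algebra.adjoin_range_eq_range_aeval]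
        congr 1
        ext i; simp
      constructor
      intro b
      rw [hr]
      obtain ⟨p, hp, hpb⟩ := hint b
      refine ⟨p.map g.rangeRestrict.toRingHom, (hp.map _).ne_zero, ?_⟩
      rw [Polynomial.aeval_def, Polynomial.eval₂_map]
      exact hpb
    have := h2.lift_cardinalMk_eq_trdeg
    simpa using this.symm
  · let := g.toRingHom.toAlgebra
    have : Algebra.IsIntegral (MvPolynomial (Fin s) k) B := ⟨hint⟩
    rw [aux_ringKrullDim_integral (MvPolynomial (Fin s) k) B hg,
      MvPolynomial.ringKrullDim_of_isNoetherianRing]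
    simp

/-! ### Field-theoretic parameter count -/

/-- The five Pfaffians over any commutative ring. -/
def auxPf {R : Type*} [CommRing R] (ω : Fin 10 → R) : Fin 5 → R :=
  ![ω 4 * ω 9 - ω 5 * ω 8 + ω 6 * ω 7,
    ω 1 * ω 9 - ω 2 * ω 8 + ω 3 * ω 7,
    ω 0 * ω 9 - ω 2 * ω 6 + ω 3 * ω 5,
    ω 0 * ω 8 - ω 1 * ω 6 + ω 3 * ω 4,
    ω 0 * ω 7 - ω 1 * ω 5 + ω 2 * ω 4]

/-- The first `τ` coefficients of `p` lie in the subfield `F`. -/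
def AuxGood {k K : Type*} [Field k] [Field K] [Algebra k K] (F : IntermediateField k K) (τ : ℕ)
    (p : PowerSeries K) : Prop := ∀ d < τ, PowerSeries.coeff d p ∈ F

section good
variable {k K : Type*} [Field k] [Field K] [Algebra k K] {F : IntermediateField k K} {τ : ℕ}
  {p q : PowerSeries K}

lemma AuxGood.add (hp : AuxGood F τ p) (hq : AuxGood F τ q) : AuxGood F τ (p + q) := by
  intro d hd
  rw [map_add]
  exact F.add_mem (hp d hd) (hq d hd)

lemma AuxGood.sub (hp : AuxGood F τ p) (hq : AuxGood F τ q) : AuxGood F τ (p - q) := by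
  intro d hd
  rw [map_sub]
  exact F.sub_mem (hp d hd) (hq d hd)

lemma AuxGood.mul (hp : AuxGood F τ p) (hq : AuxGood F τ q) : AuxGood F τ (p * q) := by
  intro d hd
  rw [PowerSeries.coeff_mul]
  refine sum_mem fun x hx => ?_
  have := Finset.HasAntidiagonal.mem_antidiagonal.mp hx
  exact F.mul_mem (hp _ (by omega)) (hq _ (by omega))

/-- Division by a power series with nonzero constant term. -/
lemma AuxGood.solve (hp : AuxGood F τ p) (h0 : PowerSeries.coeff 0 p ≠ 0)
    (hpq : AuxGood F τ (p * q)) : AuxGood F τ q := by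
  intro d
  induction d using Nat.strong_induction_on with
  | _ d ih =>
    intro hd
    have h := hpq d hd
    rw [PowerSeries.coeff_mul, Finset.Nat.sum_antidiagonal_eq_sum_range_succ
      (fun i j => PowerSeries.coeff i p * PowerSeries.coeff j q), Finset.sum_range_succ'] at h
    have h2 : ∑ i ∈ Finset.range d, PowerSeries.coeff (i + 1) p *
        PowerSeries.coeff (d - (i + 1)) q ∈ F := by
      refine sum_mem fun i hi => ?_
      have := Finset.mem_range.mp hi
      exact F.mul_mem (hp _ (by omega)) (ih _ (by omega) (by omega))
    have h3 := F.sub_mem h h2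
    rw [add_sub_cancel_left, Nat.sub_zero] at h3
    have h4 := F.mul_mem (F.inv_mem (hp 0 (by omega))) h3
    rwa [inv_mul_cancel_left₀ h0] at h4

variable {a a' b b' c c' : PowerSeries K}

/-- Solve a Pfaffian relation for a factor of the first monomial. -/
lemma AuxGood.rel1 (he : AuxGood F τ (a * a' - b * b' + c * c')) (hb : AuxGood F τ b)
    (hb' : AuxGood F τ b') (hc : AuxGood F τ c) (hc' : AuxGood F τ c') (ha : AuxGood F τ a)
    (h0 : PowerSeries.coeff 0 a ≠ 0) : AuxGood F τ a' := by
  refine ha.solve h0 ?_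
  have : a * a' = (a * a' - b * b' + c * c') + b * b' - c * c' := by ring
  rw [this]
  exact (he.add (hb.mul hb')).sub (hc.mul hc')

/-- Solve a Pfaffian relation for a factor of the second monomial. -/
lemma AuxGood.rel2 (he : AuxGood F τ (a * a' - b * b' + c * c')) (ha : AuxGood F τ a)
    (ha' : AuxGood F τ a') (hc : AuxGood F τ c) (hc' : AuxGood F τ c') (hb : AuxGood F τ b)
    (h0 : PowerSeries.coeff 0 b ≠ 0) : AuxGood F τ b' := by
  refine hb.solve h0 ?_
  have : b * b' = a * a' + c * c' - (a * a' - b * b' + c * c') := by ring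
  rw [this]
  exact ((ha.mul ha').add (hc.mul hc')).sub he

/-- Solve a Pfaffian relation for a factor of the third monomial. -/
lemma AuxGood.rel3 (he : AuxGood F τ (a * a' - b * b' + c * c')) (ha : AuxGood F τ a)
    (ha' : AuxGood F τ a') (hb : AuxGood F τ b) (hb' : AuxGood F τ b') (hc : AuxGood F τ c)
    (h0 : PowerSeries.coeff 0 c ≠ 0) : AuxGood F τ c' := by
  refine hc.solve h0 ?_
  have : c * c' = (a * a' - b * b' + c * c') + b * b' - a * a' := by ring
  rw [this]
  exact (he.add (hb.mul hb')).sub (ha.mul ha')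

end good

/-- For each entry of the matrix, the three complementary entries that are determined by the
others where that entry is invertible. -/
def auxT : Fin 10 → Finset (Fin 10) :=
  ![{7, 8, 9}, {5, 6, 9}, {4, 6, 8}, {4, 5, 7}, {2, 3, 9}, {1, 3, 8}, {1, 2, 7}, {0, 3, 6},
    {0, 2, 5}, {0, 1, 4}]

lemma auxGood_all {k K : Type*} [Field k] [Field K] [Algebra k K] {F : IntermediateField k K}
    {τ : ℕ} (w : Fin 10 → PowerSeries K)
    (hw : ∀ i, ∀ d < τ, PowerSeries.coeff d (auxPf w i) = 0) (i : Fin 10)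
    (hi : PowerSeries.coeff 0 (w i) ≠ 0) (hF : ∀ j ∉ auxT i, AuxGood F τ (w j)) :
    ∀ j, AuxGood F τ (w j) := by
  have hP : ∀ i, AuxGood F τ (auxPf w i) := fun i d hd => by
    rw [hw i d hd]; exact F.zero_mem
  have h0 : AuxGood F τ (w 4 * w 9 - w 5 * w 8 + w 6 * w 7) := hP 0
  have h1 : AuxGood F τ (w 1 * w 9 - w 2 * w 8 + w 3 * w 7) := hP 1
  have h2 : AuxGood F τ (w 0 * w 9 - w 2 * w 6 + w 3 * w 5) := hP 2
  have h3 : AuxGood F τ (w 0 * w 8 - w 1 * w 6 + w 3 * w 4) := hP 3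
  have h4 : AuxGood F τ (w 0 * w 7 - w 1 * w 5 + w 2 * w 4) := hP 4
  -- the same relations with the factors of each monomial exchanged
  have h0' : AuxGood F τ (w 9 * w 4 - w 8 * w 5 + w 7 * w 6) := by
    simpa only [mul_comm] using h0
  have h1' : AuxGood F τ (w 9 * w 1 - w 8 * w 2 + w 7 * w 3) := by
    simpa only [mul_comm] using h1
  have h2' : AuxGood F τ (w 9 * w 0 - w 6 * w 2 + w 5 * w 3) := by
    simpa only [mul_comm] using h2
  have h3' : AuxGood F τ (w 8 * w 0 - w 6 * w 1 + w 4 * w 3) := by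
    simpa only [mul_comm] using h3
  have h4' : AuxGood F τ (w 7 * w 0 - w 5 * w 1 + w 4 * w 2) := by
    simpa only [mul_comm] using h4
  intro j
  by_cases hj : j ∈ auxT i
  swap
  · exact hF j hj
  have hcases : ∀ i : Fin 10, i = 0 ∨ i = 1 ∨ i = 2 ∨ i = 3 ∨ i = 4 ∨ i = 5 ∨ i = 6 ∨ i = 7 ∨
      i = 8 ∨ i = 9 := by decide
  rcases hcases i with rfl | rfl | rfl | rfl | rfl | rfl | rfl | rfl | rfl | rfl <;>
  simp only [auxT, Fin.isValue, Matrix.cons_val, Finset.mem_insert, Finset.mem_singleton] at hj <;>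
  rcases hj with rfl | rfl | rfl <;>
  first
  | refine h0.rel1 ?_ ?_ ?_ ?_ ?_ hi <;> exact hF _ (by decide)
  | refine h0.rel2 ?_ ?_ ?_ ?_ ?_ hi <;> exact hF _ (by decide)
  | refine h0.rel3 ?_ ?_ ?_ ?_ ?_ hi <;> exact hF _ (by decide)
  | refine h0'.rel1 ?_ ?_ ?_ ?_ ?_ hi <;> exact hF _ (by decide)
  | refine h0'.rel2 ?_ ?_ ?_ ?_ ?_ hi <;> exact hF _ (by decide)
  | refine h0'.rel3 ?_ ?_ ?_ ?_ ?_ hi <;> exact hF _ (by decide)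
  | refine h1.rel1 ?_ ?_ ?_ ?_ ?_ hi <;> exact hF _ (by decide)
  | refine h1.rel2 ?_ ?_ ?_ ?_ ?_ hi <;> exact hF _ (by decide)
  | refine h1.rel3 ?_ ?_ ?_ ?_ ?_ hi <;> exact hF _ (by decide)
  | refine h1'.rel1 ?_ ?_ ?_ ?_ ?_ hi <;> exact hF _ (by decide)
  | refine h1'.rel2 ?_ ?_ ?_ ?_ ?_ hi <;> exact hF _ (by decide)
  | refine h1'.rel3 ?_ ?_ ?_ ?_ ?_ hi <;> exact hF _ (by decide)
  | refine h2.rel1 ?_ ?_ ?_ ?_ ?_ hi <;> exact hF _ (by decide)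
  | refine h2.rel2 ?_ ?_ ?_ ?_ ?_ hi <;> exact hF _ (by decide)
  | refine h2.rel3 ?_ ?_ ?_ ?_ ?_ hi <;> exact hF _ (by decide)
  | refine h2'.rel1 ?_ ?_ ?_ ?_ ?_ hi <;> exact hF _ (by decide)
  | refine h2'.rel2 ?_ ?_ ?_ ?_ ?_ hi <;> exact hF _ (by decide)
  | refine h2'.rel3 ?_ ?_ ?_ ?_ ?_ hi <;> exact hF _ (by decide)
  | refine h3.rel1 ?_ ?_ ?_ ?_ ?_ hi <;> exact hF _ (by decide)
  | refine h3.rel2 ?_ ?_ ?_ ?_ ?_ hi <;> exact hF _ (by decide)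
  | refine h3.rel3 ?_ ?_ ?_ ?_ ?_ hi <;> exact hF _ (by decide)
  | refine h3'.rel1 ?_ ?_ ?_ ?_ ?_ hi <;> exact hF _ (by decide)
  | refine h3'.rel2 ?_ ?_ ?_ ?_ ?_ hi <;> exact hF _ (by decide)
  | refine h3'.rel3 ?_ ?_ ?_ ?_ ?_ hi <;> exact hF _ (by decide)
  | refine h4.rel1 ?_ ?_ ?_ ?_ ?_ hi <;> exact hF _ (by decide)
  | refine h4.rel2 ?_ ?_ ?_ ?_ ?_ hi <;> exact hF _ (by decide)
  | refine h4.rel3 ?_ ?_ ?_ ?_ ?_ hi <;> exact hF _ (by decide)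
  | refine h4'.rel1 ?_ ?_ ?_ ?_ ?_ hi <;> exact hF _ (by decide)
  | refine h4'.rel2 ?_ ?_ ?_ ?_ ?_ hi <;> exact hF _ (by decide)
  | refine h4'.rel3 ?_ ?_ ?_ ?_ ?_ hi <;> exact hF _ (by decide)

lemma auxGood_mono {k K : Type*} [Field k] [Field K] [Algebra k K] {F G : IntermediateField k K}
    (h : F ≤ G) {τ : ℕ} {p : PowerSeries K} (hp : AuxGood F τ p) : AuxGood G τ p :=
  fun d hd => h (hp d hd)

/-- Parameter count: the coefficients of a point of the locus lie in a field generated by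
`7 τ` elements. -/
lemma aux_count (k K : Type*) [Field k] [Field K] [Algebra k K] (τ : ℕ) :
    ∀ w : Fin 10 → PowerSeries K, (∀ i, ∀ d < τ, PowerSeries.coeff d (auxPf w i) = 0) →
    ∃ s : Finset K, s.card ≤ 7 * τ ∧
      ∀ i, AuxGood (IntermediateField.adjoin k (s : Set K)) τ (w i) := by
  classical
  induction τ using Nat.strong_induction_on with
  | _ τ ih =>
  intro w hw
  by_cases h0 : ∃ i, PowerSeries.coeff 0 (w i) ≠ 0
  · obtain ⟨i, hi⟩ := h0
    refine ⟨((auxT i)ᶜ ×ˢ Finset.range τ).image (fun x => PowerSeries.coeff x.2 (w x.1)), ?_, ?_⟩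
    · refine Finset.card_image_le.trans ?_
      rw [Finset.card_product, Finset.card_range]
      have : ∀ i, (auxT i)ᶜ.card = 7 := by decide
      rw [this]
    · refine auxGood_all w hw i hi ?_
      intro j hj d hd
      apply IntermediateField.subset_adjoin
      simp only [Finset.coe_image, Set.mem_image, Finset.mem_coe]
      exact ⟨(j, d), by simp [hj, hd], rfl⟩
  · push Not at h0
    match τ, ih, hw with
    | 0, _, _ => exact ⟨∅, by simp, fun i d hd => absurd hd (by omega)⟩
    | 1, _, _ =>
      refine ⟨∅, by simp, fun i d hd => ?_⟩
      obtain rfl : d = 0 := by omega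
      rw [h0]
      exact zero_mem _
    | n + 2, ih, hw =>
      have hX : ∀ i, ∃ v : PowerSeries K, w i = PowerSeries.X * v := fun i =>
        PowerSeries.X_dvd_iff.mpr (by simpa using h0 i)
      choose v hv using hX
      have hpf : ∀ i, auxPf w i = PowerSeries.X ^ 2 * auxPf v i := by
        intro i
        fin_cases i <;> simp [auxPf, hv] <;> ring
      obtain ⟨s, hs, hsv⟩ := ih n (by omega) v (by
        intro i d hd
        have := hw i (d + 2) (by omega)
        rwa [hpf, PowerSeries.coeff_X_pow_mul] at this)
      refine ⟨s ∪ Finset.univ.image (fun i => PowerSeries.coeff (n + 1) (w i)), ?_, ?_⟩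
      · have h1 := Finset.card_union_le s
          (Finset.univ.image (fun i => PowerSeries.coeff (n + 1) (w i)))
        have h2 : (Finset.univ.image (fun i => PowerSeries.coeff (n + 1) (w i))).card ≤ 10 :=
          Finset.card_image_le.trans (by simp)
        omega
      · intro i d hd
        rcases Nat.lt_or_ge d (n + 1) with h | h
        · rcases d with _ | d
          · rw [h0]
            exact zero_mem _
          · rw [hv, PowerSeries.coeff_succ_X_mul]
            refine auxGood_mono ?_ (hsv i) d (by omega)
            apply IntermediateField.adjoin.mono
            simp
        · obtain rfl : d = n + 1 := by omega
          apply IntermediateField.subset_adjoin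
          simp

/-! ### Evaluating the generic Pfaffians -/

lemma aux_coeff_omega (k : Type*) [CommRing k] (τ : ℕ) {σ : Type*}
    (emb : Fin 10 × Fin τ → σ) (i : Fin 10) (d : ℕ) (hd : d < τ) :
    (genericOmega k τ emb i).coeff d = MvPolynomial.X (emb (i, ⟨d, hd⟩)) := by
  simp only [genericOmega, Polynomial.finsetSum_coeff, Polynomial.coeff_C_mul,
    Polynomial.coeff_X_pow]
  rw [Finset.sum_eq_single ⟨d, hd⟩]
  · simp
  · intro j _ hj
    have : d ≠ (j : ℕ) := fun h => hj (Fin.ext h.symm)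
    simp [this]
  · simp

lemma aux_coeff_pf {k : Type*} [CommRing k] {τ : ℕ} {σ : Type*} {K : Type*} [CommRing K]
    (emb : Fin 10 × Fin τ → σ) (φ : MvPolynomial σ k →+* K) (w : Fin 10 → PowerSeries K)
    (hw : ∀ i (j : Fin τ), PowerSeries.coeff (j : ℕ) (w i) = φ (MvPolynomial.X (emb (i, j))))
    (i : Fin 5) (d : ℕ) (hd : d < τ) :
    φ ((genericPfaffians k τ emb i).coeff d) = PowerSeries.coeff d (auxPf w i) := by
  have h1 : ∀ i, ∀ e < τ, φ ((genericOmega k τ emb i).coeff e) = PowerSeries.coeff e (w i) := by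
    intro i e he
    rw [aux_coeff_omega k τ emb i e he]
    exact (hw i ⟨e, he⟩).symm
  have h2 : ∀ i j, φ ((genericOmega k τ emb i * genericOmega k τ emb j).coeff d)
      = PowerSeries.coeff d (w i * w j) := by
    intro i j
    rw [Polynomial.coeff_mul, PowerSeries.coeff_mul, map_sum]
    refine Finset.sum_congr rfl fun x hx => ?_
    have := Finset.HasAntidiagonal.mem_antidiagonal.mp hx
    rw [map_mul, h1 _ _ (by omega), h1 _ _ (by omega)]
  fin_cases i <;> simp [genericPfaffians, auxPf, h2]

/-! ### Upper bound -/

lemma aux_dim_le_of_primes {B : Type*} [CommRing B] (n : WithBot ℕ∞)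
    (h : ∀ p : Ideal B, p.IsPrime → ringKrullDim (B ⧸ p) ≤ n) : ringKrullDim B ≤ n := by
  rw [ringKrullDim, Order.krullDim_eq_iSup_coheight]
  refine iSup_le fun p => ?_
  rw [Order.coheight_eq_krullDim_Ici]
  refine le_trans (le_of_eq ?_) (h p.asIdeal p.2)
  rw [ringKrullDim_quotient]
  rfl

open scoped IntermediateField.algebraAdjoinAdjoin in
lemma aux_trdeg_le (k K : Type*) [Field k] [Field K] [Algebra k K] (s : Finset K)
    (hs : IntermediateField.adjoin k (s : Set K) = ⊤) : Algebra.trdeg k K ≤ s.card := by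
  have : Algebra.IsAlgebraic (Algebra.adjoin k (s : Set K)) K := by
    constructor
    intro x
    have hx : x ∈ IntermediateField.adjoin k (s : Set K) := by rw [hs]; trivial
    have h1 := Algebra.IsAlgebraic.isAlgebraic (R := Algebra.adjoin k (s : Set K))
      (⟨x, hx⟩ : IntermediateField.adjoin k (s : Set K))
    exact h1.algebraMap (A := K)
  have := Algebra.IsAlgebraic.trdeg_le_cardinalMk k (s : Set K)
  simpa using this

lemma aux_upper (k : Type*) [Field k] (τ : ℕ) :
    ringKrullDim (MvPolynomial (Fin 10 × Fin τ) k ⧸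
        pfaffianLocusIdeal k τ (id : Fin 10 × Fin τ → Fin 10 × Fin τ)) ≤ (7 * τ : ℕ) := by
  set I := pfaffianLocusIdeal k τ (id : Fin 10 × Fin τ → Fin 10 × Fin τ) with hI
  refine aux_dim_le_of_primes _ fun p hp => ?_
  let C := (MvPolynomial (Fin 10 × Fin τ) k ⧸ I) ⧸ p
  have hC : IsDomain C := Ideal.Quotient.isDomain p
  let K := FractionRing C
  let ψ : MvPolynomial (Fin 10 × Fin τ) k →ₐ[k] C :=
    (Ideal.Quotient.mkₐ k p).comp (Ideal.Quotient.mkₐ k I)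
  have hψ : Function.Surjective ψ :=
    (Ideal.Quotient.mkₐ_surjective k p).comp (Ideal.Quotient.mkₐ_surjective k I)
  let φ : MvPolynomial (Fin 10 × Fin τ) k →ₐ[k] K := (IsScalarTower.toAlgHom k C K).comp ψ
  have hφI : ∀ q ∈ I, φ q = 0 := by
    intro q hq
    have h1 : Ideal.Quotient.mk I q = 0 := Ideal.Quotient.eq_zero_iff_mem.mpr hq
    have h2 : ψ q = 0 := by
      change Ideal.Quotient.mk p (Ideal.Quotient.mk I q) = 0
      rw [h1, map_zero]
    change algebraMap C K (ψ q) = 0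
    rw [h2, map_zero]
  let w : Fin 10 → PowerSeries K := fun i => PowerSeries.mk fun d =>
    if h : d < τ then φ (MvPolynomial.X (i, ⟨d, h⟩)) else 0
  have hw : ∀ i (j : Fin τ), PowerSeries.coeff (j : ℕ) (w i)
      = φ (MvPolynomial.X (id (i, j))) := by
    intro i j
    simp [w]
  obtain ⟨s, hs, hsw⟩ := aux_count k K τ w (by
    intro i d hd
    have := aux_coeff_pf id φ.toRingHom w hw i d hd
    rw [← this]
    exact hφI _ (Ideal.subset_span ⟨i, d, hd, rfl⟩))
  have hX : ∀ q, φ q ∈ IntermediateField.adjoin k (s : Set K) := by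
    intro q
    induction q using MvPolynomial.induction_on with
    | C a =>
      rw [← MvPolynomial.algebraMap_eq, φ.commutes]
      exact IntermediateField.algebraMap_mem _ a
    | add q r hq hr => rw [map_add]; exact add_mem hq hr
    | mul_X q x hq =>
      rw [map_mul]
      refine mul_mem hq ?_
      have := hsw x.1 x.2 x.2.2
      rwa [hw] at this
  have htop : IntermediateField.adjoin k (s : Set K) = ⊤ := by
    rw [eq_top_iff]
    intro x _
    obtain ⟨a, b, -, rfl⟩ := IsFractionRing.div_surjective (A := C) x
    obtain ⟨a, rfl⟩ := hψ a
    obtain ⟨b, rfl⟩ := hψ b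
    exact div_mem (hX a) (hX b)
  have h1 := aux_trdeg_le k K s htop
  have h2 : Algebra.trdeg k C ≤ Algebra.trdeg k K :=
    trdeg_le_of_injective (IsScalarTower.toAlgHom k C K) (IsFractionRing.injective C K)
  obtain ⟨m, hm, hdim⟩ := aux_dim_eq_trdeg k C
  rw [hdim]
  rw [hm] at h2
  have h3 : m ≤ s.card := by exact_mod_cast h2.trans h1
  exact_mod_cast h3.trans hs

/-! ### Lower bound -/

lemma aux_lower (k : Type*) [Field k] (τ : ℕ) (hτ : 1 ≤ τ) :
    ((7 * τ : ℕ) : WithBot ℕ∞) ≤ ringKrullDim (MvPolynomial (Fin 10 × Fin τ) k ⧸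
        pfaffianLocusIdeal k τ (id : Fin 10 × Fin τ → Fin 10 × Fin τ)) := by
  set I := pfaffianLocusIdeal k τ (id : Fin 10 × Fin τ → Fin 10 × Fin τ) with hI
  set P := MvPolynomial (Fin 7 × Fin τ) k
  set L := FractionRing P
  -- the seven free entries
  let x : Fin 7 × Fin τ → L := fun y => algebraMap P L (MvPolynomial.X y)
  have hx : AlgebraicIndependent k x :=
    (MvPolynomial.algebraicIndependent_X (Fin 7 × Fin τ) k).map' (f := IsScalarTower.toAlgHom k P L)
      (IsFractionRing.injective P L)
  let u : Fin 7 → PowerSeries L := fun i => PowerSeries.mk fun d =>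
    if h : d < τ then x (i, ⟨d, h⟩) else 0
  have hu : ∀ i (j : Fin τ), PowerSeries.coeff (j : ℕ) (u i) = x (i, j) := by
    intro i j
    simp [u]
  have hu0 : PowerSeries.constantCoeff (u 0) ≠ 0 := by
    have := hu 0 ⟨0, hτ⟩
    rw [← PowerSeries.coeff_zero_eq_constantCoeff_apply]
    change PowerSeries.coeff 0 (u 0) = _ at this
    rw [this]
    exact hx.ne_zero _
  have hinv : u 0 * (u 0)⁻¹ = 1 := PowerSeries.mul_inv_cancel _ hu0
  let w : Fin 10 → PowerSeries L := ![u 0, u 1, u 2, u 3, u 4, u 5, u 6,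
    (u 0)⁻¹ * (u 1 * u 5 - u 2 * u 4), (u 0)⁻¹ * (u 1 * u 6 - u 3 * u 4),
    (u 0)⁻¹ * (u 2 * u 6 - u 3 * u 5)]
  have hpf : ∀ i, auxPf w i = 0 := by
    intro i
    fin_cases i
    · change u 4 * ((u 0)⁻¹ * (u 2 * u 6 - u 3 * u 5)) - u 5 * ((u 0)⁻¹ * (u 1 * u 6 - u 3 * u 4))
        + u 6 * ((u 0)⁻¹ * (u 1 * u 5 - u 2 * u 4)) = 0
      ring
    · change u 1 * ((u 0)⁻¹ * (u 2 * u 6 - u 3 * u 5)) - u 2 * ((u 0)⁻¹ * (u 1 * u 6 - u 3 * u 4))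
        + u 3 * ((u 0)⁻¹ * (u 1 * u 5 - u 2 * u 4)) = 0
      ring
    · change u 0 * ((u 0)⁻¹ * (u 2 * u 6 - u 3 * u 5)) - u 2 * u 6 + u 3 * u 5 = 0
      linear_combination (u 2 * u 6 - u 3 * u 5) * hinv
    · change u 0 * ((u 0)⁻¹ * (u 1 * u 6 - u 3 * u 4)) - u 1 * u 6 + u 3 * u 4 = 0
      linear_combination (u 1 * u 6 - u 3 * u 4) * hinv
    · change u 0 * ((u 0)⁻¹ * (u 1 * u 5 - u 2 * u 4)) - u 1 * u 5 + u 2 * u 4 = 0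
      linear_combination (u 1 * u 5 - u 2 * u 4) * hinv
  let φ : MvPolynomial (Fin 10 × Fin τ) k →ₐ[k] L :=
    MvPolynomial.aeval fun y => PowerSeries.coeff (y.2 : ℕ) (w y.1)
  have hφX : ∀ y, φ (MvPolynomial.X y) = PowerSeries.coeff (y.2 : ℕ) (w y.1) := fun y => by
    simp [φ]
  have hφI : I ≤ RingHom.ker φ.rangeRestrict := by
    rw [hI, pfaffianLocusIdeal, Ideal.span_le]
    rintro q ⟨i, d, hd, rfl⟩
    have h1 := aux_coeff_pf id φ.toRingHom w (fun i j => (hφX (i, j)).symm) i d hd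
    rw [hpf, map_zero] at h1
    exact Subtype.ext h1
  have hsurj : Function.Surjective (Ideal.Quotient.lift I φ.rangeRestrict.toRingHom hφI) :=
    Ideal.Quotient.lift_surjective_of_surjective _ _ φ.rangeRestrict_surjective
  refine le_trans ?_ (ringKrullDim_le_of_surjective _ hsurj)
  have hft : Algebra.FiniteType k φ.range :=
    Algebra.FiniteType.of_surjective φ.rangeRestrict φ.rangeRestrict_surjective
  obtain ⟨m, hm, hdim⟩ := aux_dim_eq_trdeg k φ.range
  rw [hdim]
  have hmem : ∀ y, x y ∈ φ.range := by
    rintro ⟨i, j⟩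
    refine ⟨MvPolynomial.X (Fin.castLE (by norm_num) i, j), ?_⟩
    refine (hφX _).trans ?_
    rw [← hu i j]
    congr 1
    fin_cases i <;> rfl
  have hx' : AlgebraicIndependent k (fun y => (⟨x y, hmem y⟩ : φ.range)) :=
    AlgebraicIndependent.of_comp φ.range.val hx
  have h1 := hx'.lift_cardinalMk_le_trdeg
  rw [hm] at h1
  have h2 : 7 * τ ≤ m := by
    simp at h1
    exact_mod_cast h1
  exact_mod_cast h2

/-! ### The product with an affine space -/

lemma aux_rename_pf (k : Type*) [CommRing k] (τ : ℕ) {σ : Type*} (emb : Fin 10 × Fin τ → σ)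
    (i : Fin 5) : genericPfaffians k τ emb i
      = (genericPfaffians k τ id i).map (MvPolynomial.rename (R := k) emb).toRingHom := by
  have h : ∀ j, (genericOmega k τ id j).map (MvPolynomial.rename (R := k) emb).toRingHom
      = genericOmega k τ emb j := by
    intro j
    simp [genericOmega, Polynomial.map_sum]
  fin_cases i <;> simp [genericPfaffians, ← h]

lemma aux_ideal_map (k : Type*) [CommRing k] (τ : ℕ) {σ : Type*} (emb : Fin 10 × Fin τ → σ) :
    pfaffianLocusIdeal k τ emb
      = (pfaffianLocusIdeal k τ id).map (MvPolynomial.rename (R := k) emb).toRingHom := by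
  rw [pfaffianLocusIdeal, pfaffianLocusIdeal, Ideal.map_span]
  congr 1
  ext q
  constructor
  · rintro ⟨i, d, hd, rfl⟩
    exact ⟨_, ⟨i, d, hd, rfl⟩, by rw [aux_rename_pf k τ emb, Polynomial.coeff_map]⟩
  · rintro ⟨_, ⟨i, d, hd, rfl⟩, rfl⟩
    exact ⟨i, d, hd, by rw [aux_rename_pf k τ emb, Polynomial.coeff_map]⟩

lemma aux_product (k : Type*) [Field k] (τ n : ℕ) :
    ringKrullDim (MvPolynomial (Fin n ⊕ Fin 10 × Fin τ) k ⧸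
        pfaffianLocusIdeal k τ (Sum.inr : Fin 10 × Fin τ → Fin n ⊕ Fin 10 × Fin τ))
      = ringKrullDim (MvPolynomial (Fin 10 × Fin τ) k ⧸
        pfaffianLocusIdeal k τ (id : Fin 10 × Fin τ → Fin 10 × Fin τ)) + n := by
  set I := pfaffianLocusIdeal k τ (id : Fin 10 × Fin τ → Fin 10 × Fin τ) with hI
  have e1 := MvPolynomial.quotientEquivQuotientMvPolynomial (σ := Fin n) I
  have e2 : (MvPolynomial (Fin n ⊕ Fin 10 × Fin τ) k ⧸
      pfaffianLocusIdeal k τ (Sum.inr : Fin 10 × Fin τ → Fin n ⊕ Fin 10 × Fin τ)) ≃+*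
      (MvPolynomial (Fin n) (MvPolynomial (Fin 10 × Fin τ) k) ⧸
        Ideal.map (MvPolynomial.C (σ := Fin n)) I) := Ideal.quotientEquiv
    (pfaffianLocusIdeal k τ (Sum.inr : Fin 10 × Fin τ → Fin n ⊕ Fin 10 × Fin τ))
    (Ideal.map (MvPolynomial.C (σ := Fin n)) I)
    (MvPolynomial.sumAlgEquiv k (Fin n) (Fin 10 × Fin τ)).toRingEquiv (by
      rw [aux_ideal_map, Ideal.map_map]
      congr 1
      refine MvPolynomial.ringHom_ext ?_ ?_
      · intro r
        simp
      · intro y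
        simp)
  have h2 : ringKrullDim _ = ringKrullDim (MvPolynomial (Fin n) (MvPolynomial (Fin 10 × Fin τ) k) ⧸
        Ideal.map (MvPolynomial.C (σ := Fin n)) I) := ringKrullDim_eq_of_ringEquiv e2
  rw [h2, ← ringKrullDim_eq_of_ringEquiv e1.toRingEquiv,
    MvPolynomial.ringKrullDim_of_isNoetherianRing]
  simp

/-- Over an algebraically closed field `k` of characteristic zero and `τ ≥ 1`,
the affine algebraic set `𝒩 ⊆ R^{10} ≅ 𝔸^{10τ}` (with `R = k[X]/(X^τ)`) defined by the
vanishing in `R` of the five `4×4` Pfaffians has dimension `7τ`, and consequently the quadratic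
quasi-cone `𝒬 = 𝔸^{τ+8} × 𝒩` has dimension `8τ + 8`.  Dimension is the Krull dimension of
the coordinate ring. -/
theorem pfaffian_locus_dimension_family_one
    (k : Type*) [Field k] [IsAlgClosed k] [CharZero k] (τ : ℕ) (hτ : 1 ≤ τ) :
    ringKrullDim (MvPolynomial (Fin 10 × Fin τ) k ⧸
        pfaffianLocusIdeal k τ (id : Fin 10 × Fin τ → Fin 10 × Fin τ)) = (7 * τ : ℕ) ∧
    ringKrullDim (MvPolynomial (Fin (τ + 8) ⊕ Fin 10 × Fin τ) k ⧸
        pfaffianLocusIdeal k τ (Sum.inr : Fin 10 × Fin τ → Fin (τ + 8) ⊕ Fin 10 × Fin τ))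
      = (8 * τ + 8 : ℕ) := by
  have h1 : ringKrullDim (MvPolynomial (Fin 10 × Fin τ) k ⧸
      pfaffianLocusIdeal k τ (id : Fin 10 × Fin τ → Fin 10 × Fin τ)) = (7 * τ : ℕ) :=
    le_antisymm (aux_upper k τ) (aux_lower k τ hτ)
  refine ⟨h1, ?_⟩
  rw [aux_product, h1]
  have : 8 * τ + 8 = 7 * τ + (τ + 8) := by omega
  rw [this]
  push_cast
  rfl
end

section
/- Let k be an algebraically closed field of characteristic zero, τ ≥ 1 an integer, and R = k[X]/(X^τ). Let 𝒩 ⊆ R^{10} ≅ 𝔸^{10τ} be the Zariski-closed subset of tuples (ω₁,...,ω₁₀) ∈ R^{10} such that the five 4×4 Pfaffians of the 5×5 skew-symmetric matrix with above-diagonal entries m₁₂=ω₁, m₁₃=ω₂, m₁₄=ω₃, m₁₅=ω₄, m₂₃=ω₅, m₂₄=ω₆, m₂₅=ω₇, m₃₄=ω₈, m₃₅=ω₉, m₄₅=ω₁₀ all vanish in R. Then the affine cone 𝒬ₙ = 𝔸^{τ+4} × 𝒩 has dimension 8τ + 4. -/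
open Polynomial in
lemma max_height {k : Type*} [Field k] {ι : Type*} [Finite ι] :
    ∀ (M : Ideal (MvPolynomial ι k)), M.IsMaximal → (Nat.card ι : ℕ∞) ≤ M.height := by
  induction ι using Finite.induction_empty_option with
  | of_equiv e H =>
    intro M hM
    let f := (MvPolynomial.renameEquiv k e).toRingEquiv
    have h1 : (M.comap f).IsMaximal := Ideal.comap_isMaximal_of_equiv f
    have := H _ h1
    rwa [RingEquiv.height_comap, Nat.card_congr e] at this
  | h_empty => simp
  | @h_option ι _ IH =>
    intro M hM
    let f := (MvPolynomial.optionEquivLeft k ι).symm.toRingEquiv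
    have h1 : (M.comap f).IsMaximal := Ideal.comap_isMaximal_of_equiv f
    have h2 : ((M.comap f).under (MvPolynomial ι k)).IsMaximal :=
      Polynomial.isMaximal_comap_C_of_isJacobsonRing _
    have := IH _ h2
    have h3 : (M.comap f).LiesOver ((M.comap f).under (MvPolynomial ι k)) := ⟨rfl⟩
    rw [← RingEquiv.height_comap f,
      Polynomial.height_eq_height_add_one ((M.comap f).under (MvPolynomial ι k)) (M.comap f)]
    simp only [Nat.card_eq_fintype_card, Fintype.card_option, Nat.cast_add, Nat.cast_one] at this ⊢
    gcongr

lemma dim_le {k A : Type*} [Field k] [CommRing A] [Algebra k A] [Algebra.FiniteType k A] (n : ℕ)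
    (h : ∀ P : Ideal A, P.IsPrime → Algebra.trdeg k (A ⧸ P) ≤ n) : ringKrullDim A ≤ n := by
  nontriviality A
  obtain ⟨s, g, hg, hint⟩ := exists_integral_inj_algHom_of_fg k A
  let _ := g.toRingHom.toAlgebra
  have hI : Algebra.IsIntegral (MvPolynomial (Fin s) k) A := ⟨hint⟩
  have h1 : ringKrullDim A ≤ ringKrullDim (MvPolynomial (Fin s) k) := by
    refine Order.krullDim_le_of_strictMono
      (fun q => PrimeSpectrum.comap (algebraMap (MvPolynomial (Fin s) k) A) q) ?_
    intro p q hpq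
    exact Ideal.IsIntegral.comap_lt_comap (R := MvPolynomial (Fin s) k) (I := p.asIdeal) (J := q.asIdeal) hpq
  refine h1.trans ?_
  simp only [MvPolynomial.ringKrullDim_of_isNoetherianRing, ringKrullDim_eq_zero_of_field,
    Nat.card_eq_fintype_card, Fintype.card_fin, zero_add]
  obtain ⟨Q, -, hQ, hQ2⟩ := Ideal.exists_ideal_over_prime_of_isIntegral
    (R := MvPolynomial (Fin s) k) (⊥ : Ideal (MvPolynomial (Fin s) k)) (⊥ : Ideal A)
    (by
      intro x hx
      have : g x = 0 := hx
      simpa using hg (this.trans (map_zero g).symm))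
  have hQ3 := h Q hQ
  let g' : MvPolynomial (Fin s) k →ₐ[k] A ⧸ Q := (Ideal.Quotient.mkₐ k Q).comp g
  have hg' : Function.Injective g' := by
    rw [injective_iff_map_eq_zero]
    intro a ha
    have : g a ∈ Q := Ideal.Quotient.eq_zero_iff_mem.mp ha
    have : a ∈ (⊥ : Ideal (MvPolynomial (Fin s) k)) := by rw [← hQ2]; exact this
    simpa using this
  have h4 := lift_trdeg_le_of_injective g' hg'
  rw [MvPolynomial.trdeg_of_isDomain] at h4
  have h5 := h4.trans (Cardinal.lift_le.mpr hQ3)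
  simp at h5
  exact_mod_cast h5

lemma trdeg_le_of_adjoin {k D L : Type*} [Field k] [CommRing D] [IsDomain D] [Algebra k D] [Field L]
    [Algebra k L] [Algebra D L] [IsScalarTower k D L] [IsFractionRing D L] (n : ℕ)
    (S : Finset L) (hS : S.card ≤ n) (G : Set D) (hG : Algebra.adjoin k G = ⊤)
    (h : ∀ x ∈ G, algebraMap D L x ∈ IntermediateField.adjoin k (S : Set L)) :
    Algebra.trdeg k D ≤ n := by
  have key : ∀ d : D, algebraMap D L d ∈ IntermediateField.adjoin k (S : Set L) := by
    intro d
    have hd : d ∈ Algebra.adjoin k G := hG ▸ Algebra.mem_top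
    have : Algebra.adjoin k G ≤
        (IntermediateField.adjoin k (S : Set L)).toSubalgebra.comap (IsScalarTower.toAlgHom k D L) :=
      Algebra.adjoin_le fun x hx => h x hx
    exact this hd
  have top : ∀ x : L, x ∈ IntermediateField.adjoin k (S : Set L) := by
    intro x
    obtain ⟨a, b, -, rfl⟩ := IsFractionRing.div_surjective (A := D) x
    exact div_mem (key a) (key b)
  have alg : Algebra.IsAlgebraic (Algebra.adjoin k (S : Set L)) L := by
    constructor
    intro x
    obtain ⟨r, hr, s, hs, rfl⟩ := IntermediateField.mem_adjoin_iff_div.mp (top x)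
    rw [div_eq_mul_inv]
    exact (isAlgebraic_algebraMap (⟨r, hr⟩ : Algebra.adjoin k (S : Set L))).mul
      (isAlgebraic_algebraMap (⟨s, hs⟩ : Algebra.adjoin k (S : Set L))).inv
  have h1 := Algebra.IsAlgebraic.trdeg_le_cardinalMk k (S : Set L)
  have h2 := lift_trdeg_le_of_injective (IsScalarTower.toAlgHom k D L) (IsFractionRing.injective D L)
  have h3 := h2.trans (Cardinal.lift_le.mpr h1)
  simp at h3
  exact h3.trans (by exact_mod_cast hS)

lemma dim_ge {R : Type*} [CommRing R] [IsNoetherianRing R] (I : Ideal R) (s : Set R) (m : Ideal R)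
    [m.IsPrime] (hs : s ⊆ m) (h : ∀ q : Ideal R, q.IsPrime → s ⊆ q → q ≤ m → I ≤ q) :
    (m.height : WithBot ℕ∞) ≤ ringKrullDim (R ⧸ I) + s.encard := by
  have h1 := Ideal.height_le_height_add_encard_of_subset s hs
  have hle : Ideal.span s ≤ m := Ideal.span_le.mpr hs
  have hp : (m.map (Ideal.Quotient.mk (Ideal.span s))).IsPrime :=
    Ideal.isPrime_map_quotientMk_of_isPrime hle
  let m' : PrimeSpectrum (R ⧸ Ideal.span s) := ⟨_, hp⟩
  have hm' : m'.asIdeal.comap (Ideal.Quotient.mk (Ideal.span s)) = m := by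
    simp only [m']
    rw [Ideal.comap_map_of_surjective _ Ideal.Quotient.mk_surjective, ← RingHom.ker_eq_comap_bot,
      Ideal.mk_ker, sup_eq_left.mpr hle]
  have h2 : ((m.map (Ideal.Quotient.mk (Ideal.span s))).height : WithBot ℕ∞) ≤
      ringKrullDim (R ⧸ I) := by
    have e : (m.map (Ideal.Quotient.mk (Ideal.span s))).height = Order.height m' :=
      PrimeSpectrum.height_eq_orderHeight m'
    rw [e, Order.height_eq_krullDim_Iic, ringKrullDim_quotient]
    have mono : StrictMono (PrimeSpectrum.comap (Ideal.Quotient.mk (Ideal.span s))) :=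
      RingHom.strictMono_comap_of_surjective Ideal.Quotient.mk_surjective
    refine Order.krullDim_le_of_strictMono
      (fun q => ⟨PrimeSpectrum.comap (Ideal.Quotient.mk (Ideal.span s)) q.1, ?_⟩) ?_
    · refine (PrimeSpectrum.mem_zeroLocus _ _).mpr (h _ (PrimeSpectrum.isPrime _) ?_ ?_)
      · intro x hx
        have : Ideal.Quotient.mk (Ideal.span s) x = 0 :=
          Ideal.Quotient.eq_zero_iff_mem.mpr (Ideal.subset_span hx)
        simp [this]
      · rw [← hm']
        exact Ideal.comap_mono q.2
    · intro a b hab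
      exact mono hab
  calc (m.height : WithBot ℕ∞) ≤
      (((m.map (Ideal.Quotient.mk (Ideal.span s))).height + s.encard : ℕ∞) : WithBot ℕ∞) := by
        exact_mod_cast h1
    _ ≤ _ := by
        rw [WithBot.coe_add]
        gcongr

/-- The five Pfaffians in any commutative ring. -/
def pfaf {B : Type*} [CommRing B] (ω : Fin 10 → B) : Fin 5 → B :=
  ![ω 4 * ω 9 - ω 5 * ω 8 + ω 6 * ω 7,
    ω 1 * ω 9 - ω 2 * ω 8 + ω 3 * ω 7,
    ω 0 * ω 9 - ω 2 * ω 6 + ω 3 * ω 5,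
    ω 0 * ω 8 - ω 1 * ω 6 + ω 3 * ω 4,
    ω 0 * ω 7 - ω 1 * ω 5 + ω 2 * ω 4]

lemma map_pfaf {B C : Type*} [CommRing B] [CommRing C] (f : B →+* C) (ω : Fin 10 → B) (i : Fin 5) :
    f (pfaf ω i) = pfaf (fun l => f (ω l)) i := by
  fin_cases i <;> simp [pfaf]

section core
open Polynomial

lemma coeffs_mul {k L : Type*} [Field k] [Field L] [Algebra k L] (F : IntermediateField k L)
    (n : ℕ) (p q : L[X]) (hp : ∀ j < n, p.coeff j ∈ F) (hq : ∀ j < n, q.coeff j ∈ F) :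
    ∀ j < n, (p * q).coeff j ∈ F := by
  intro j hj
  rw [coeff_mul]
  refine sum_mem fun x hx => ?_
  have := Finset.HasAntidiagonal.mem_antidiagonal.mp hx
  exact mul_mem (hp _ (by omega)) (hq _ (by omega))

lemma coeffs_div {k L : Type*} [Field k] [Field L] [Algebra k L] (F : IntermediateField k L)
    (n : ℕ) (u v r : L[X]) (h0 : u.coeff 0 ≠ 0) (hu : ∀ j < n, u.coeff j ∈ F)
    (hr : ∀ j < n, r.coeff j ∈ F) (h : X ^ n ∣ u * v - r) : ∀ j < n, v.coeff j ∈ F := by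
  rw [X_pow_dvd_iff] at h
  intro j
  induction j using Nat.strong_induction_on with
  | _ j ih =>
    intro hj
    have h1 := h j hj
    rw [coeff_sub, coeff_mul, Finset.Nat.sum_antidiagonal_eq_sum_range_succ_mk,
      Finset.sum_range_succ'] at h1
    simp only [tsub_zero] at h1
    have h2 : v.coeff j = (r.coeff j - ∑ i ∈ Finset.range j, u.coeff (i + 1) * v.coeff (j - (i + 1)))
        / u.coeff 0 := by
      rw [eq_div_iff h0]; linear_combination h1
    rw [h2]
    refine div_mem (sub_mem (hr j hj) (sum_mem fun i hi => ?_)) (hu 0 (by omega))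
    have := Finset.mem_range.mp hi
    exact mul_mem (hu _ (by omega)) (ih _ (by omega) (by omega))

lemma core_unit {k L : Type*} [Field k] [Field L] [Algebra k L] (n : ℕ) (w : Fin 10 → L[X])
    (T : Finset (Fin 10)) (hT : T.card ≤ 7) (i : Fin 10) (hi : i ∈ T) (h0 : (w i).coeff 0 ≠ 0)
    (h : ∀ l ∉ T, ∃ a ∈ T, ∃ b ∈ T, ∃ c ∈ T, ∃ d ∈ T,
      X ^ n ∣ w i * w l - (w a * w b - w c * w d) ∨ X ^ n ∣ w i * w l - (w a * w b + w c * w d)) :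
    ∃ S : Finset L, S.card ≤ 7 * n ∧
      ∀ i, ∀ j < n, (w i).coeff j ∈ IntermediateField.adjoin k (S : Set L) := by
  classical
  refine ⟨(T ×ˢ Finset.range n).image fun x => (w x.1).coeff x.2, ?_, ?_⟩
  · refine Finset.card_image_le.trans ?_
    rw [Finset.card_product, Finset.card_range]
    gcongr
  · generalize hF : IntermediateField.adjoin k (_ : Set L) = F
    have hmem : ∀ l ∈ T, ∀ j < n, (w l).coeff j ∈ F := by
      intro l hl j hj
      rw [← hF]
      apply IntermediateField.subset_adjoin
      simp only [Finset.coe_image, Set.mem_image, Finset.mem_coe, Finset.mem_product,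
        Finset.mem_range]
      exact ⟨(l, j), ⟨hl, hj⟩, rfl⟩
    intro l
    by_cases hl : l ∈ T
    · exact hmem l hl
    · obtain ⟨a, ha, b, hb, c, hc, d, hd, h | h⟩ := h l hl
      · refine coeffs_div F n _ _ _ h0 (hmem i hi) ?_ h
        intro j hj
        rw [coeff_sub]
        exact sub_mem (coeffs_mul F n _ _ (hmem a ha) (hmem b hb) j hj)
          (coeffs_mul F n _ _ (hmem c hc) (hmem d hd) j hj)
      · refine coeffs_div F n _ _ _ h0 (hmem i hi) ?_ h
        intro j hj
        rw [coeff_add]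
        exact add_mem (coeffs_mul F n _ _ (hmem a ha) (hmem b hb) j hj)
          (coeffs_mul F n _ _ (hmem c hc) (hmem d hd) j hj)

/-- The indices of the pairs meeting the pair with index `i`, including `i` itself. -/
def nbrs : Fin 10 → Finset (Fin 10) :=
  ![{0,1,2,3,4,5,6}, {0,1,2,3,4,7,8}, {0,1,2,3,5,7,9}, {0,1,2,3,6,8,9}, {0,1,4,5,6,7,8},
    {0,2,4,5,6,7,9}, {0,3,4,5,6,8,9}, {1,2,4,5,7,8,9}, {1,3,4,6,7,8,9}, {2,3,5,6,7,8,9}]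

/-- The relation `± w i w l = w a w b ± w c w d` read off from a Pfaffian `p - q + r`. -/
lemma pick {B : Type*} [CommRing B] {x p q r : B} (h : x ∣ p - q + r) :
    x ∣ p - (q - r) ∧ x ∣ q - (p + r) ∧ x ∣ r - (q - p) :=
  ⟨by convert! h using 1; ring, by rw [← dvd_neg]; convert! h using 1; ring,
    by convert! h using 1; ring⟩

lemma core {k L : Type*} [Field k] [Field L] [Algebra k L] (n : ℕ) : ∀ (w : Fin 10 → L[X]),
    (∀ i, X ^ n ∣ pfaf w i) → ∃ S : Finset L, S.card ≤ 7 * n ∧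
      ∀ i, ∀ j < n, (w i).coeff j ∈ IntermediateField.adjoin k (S : Set L) := by
  induction n using Nat.strong_induction_on with
  | _ n ih =>
  intro w hw
  by_cases hz : ∀ i, (w i).coeff 0 = 0
  · rcases n with _ | _ | n
    · exact ⟨∅, by simp, by simp⟩
    · refine ⟨∅, by simp, fun i j hj => ?_⟩
      obtain rfl : j = 0 := by omega
      rw [hz]; exact zero_mem _
    · classical
      have e : ∀ i, w i = X * (w i).divX := by
        intro i
        conv_lhs => rw [← X_mul_divX_add (w i), hz i]
        simp
      obtain ⟨S, hS, hS2⟩ := ih n (by omega) (fun i => (w i).divX) (by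
        intro i
        have h1 := hw i
        have h2 : pfaf w i = X ^ 2 * pfaf (fun i => (w i).divX) i := by
          generalize hv : (fun i => (w i).divX) = v
          have e' : w = fun i => X * v i := by
            funext i; rw [e i, ← hv]
          rw [e']
          fin_cases i <;> simp [pfaf] <;> ring
        rw [h2, show n + 1 + 1 = 2 + n by ring, pow_add] at h1
        exact (mul_dvd_mul_iff_left (pow_ne_zero 2 X_ne_zero)).mp h1)
      refine ⟨S ∪ Finset.univ.image (fun i => (w i).coeff (n + 1)), ?_, ?_⟩
      · refine (Finset.card_union_le _ _).trans ?_
        have : (Finset.univ.image (fun i => (w i).coeff (n + 1))).card ≤ 10 :=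
          Finset.card_image_le.trans (by simp)
        omega
      · intro i j hj
        rcases j with _ | j
        · rw [hz]; exact zero_mem _
        · rcases Nat.lt_or_ge j n with h | h
          · have := hS2 i j h
            rw [coeff_divX] at this
            exact IntermediateField.adjoin.mono k _ _ (by simp) this
          · obtain rfl : j = n := by omega
            apply IntermediateField.subset_adjoin
            simp
  · push Not at hz
    obtain ⟨i, hi⟩ := hz
    have card7 : ∀ i, (nbrs i).card ≤ 7 := by decide
    have self_mem : ∀ i, i ∈ nbrs i := by decide
    have hc : ∀ i l a b, X ^ n ∣ w i * w l - (a - b) → X ^ n ∣ w l * w i - (a - b) := by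
      intro i l a b h; rwa [mul_comm (w l)]
    have hc' : ∀ i l a b, X ^ n ∣ w i * w l - (a + b) → X ^ n ∣ w l * w i - (a + b) := by
      intro i l a b h; rwa [mul_comm (w l)]
    obtain ⟨a0, b0, c0⟩ := pick (p := w 4 * w 9) (q := w 5 * w 8) (r := w 6 * w 7) (hw 0)
    obtain ⟨a1, b1, c1⟩ := pick (p := w 1 * w 9) (q := w 2 * w 8) (r := w 3 * w 7) (hw 1)
    obtain ⟨a2, b2, c2⟩ := pick (p := w 0 * w 9) (q := w 2 * w 6) (r := w 3 * w 5) (hw 2)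
    obtain ⟨a3, b3, c3⟩ := pick (p := w 0 * w 8) (q := w 1 * w 6) (r := w 3 * w 4) (hw 3)
    obtain ⟨a4, b4, c4⟩ := pick (p := w 0 * w 7) (q := w 1 * w 5) (r := w 2 * w 4) (hw 4)
    refine core_unit n w (nbrs i) (card7 i) i (self_mem i) hi ?_
    clear hi
    have hcomp : ∀ i l, l ∉ nbrs i → (i, l) ∈ ({(0, 7), (0, 8), (0, 9), (1, 5), (1, 6), (1, 9), (2, 4), (2, 6), (2, 8), (3, 4), (3, 5), (3, 7), (4, 2), (4, 3), (4, 9), (5, 1), (5, 3), (5, 8), (6, 1), (6, 2), (6, 7), (7, 0), (7, 3), (7, 6), (8, 0), (8, 2), (8, 5), (9, 0), (9, 1), (9, 4)} : Finset (Fin 10 × Fin 10)) := by decide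
    intro l hl
    have hil := hcomp i l hl
    simp only [Finset.mem_insert, Finset.mem_singleton, Prod.mk.injEq] at hil
    rcases hil with ⟨rfl, rfl⟩ | ⟨rfl, rfl⟩ | ⟨rfl, rfl⟩ | ⟨rfl, rfl⟩ | ⟨rfl, rfl⟩ | ⟨rfl, rfl⟩ | ⟨rfl, rfl⟩ | ⟨rfl, rfl⟩ | ⟨rfl, rfl⟩ | ⟨rfl, rfl⟩ | ⟨rfl, rfl⟩ | ⟨rfl, rfl⟩ | ⟨rfl, rfl⟩ | ⟨rfl, rfl⟩ | ⟨rfl, rfl⟩ | ⟨rfl, rfl⟩ | ⟨rfl, rfl⟩ | ⟨rfl, rfl⟩ | ⟨rfl, rfl⟩ | ⟨rfl, rfl⟩ | ⟨rfl, rfl⟩ | ⟨rfl, rfl⟩ | ⟨rfl, rfl⟩ | ⟨rfl, rfl⟩ | ⟨rfl, rfl⟩ | ⟨rfl, rfl⟩ | ⟨rfl, rfl⟩ | ⟨rfl, rfl⟩ | ⟨rfl, rfl⟩ | ⟨rfl, rfl⟩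
    · exact ⟨1, by decide, 5, by decide, 2, by decide, 4, by decide, .inl a4⟩
    · exact ⟨1, by decide, 6, by decide, 3, by decide, 4, by decide, .inl a3⟩
    · exact ⟨2, by decide, 6, by decide, 3, by decide, 5, by decide, .inl a2⟩
    · exact ⟨0, by decide, 7, by decide, 2, by decide, 4, by decide, .inr b4⟩
    · exact ⟨0, by decide, 8, by decide, 3, by decide, 4, by decide, .inr b3⟩
    · exact ⟨2, by decide, 8, by decide, 3, by decide, 7, by decide, .inl a1⟩
    · exact ⟨1, by decide, 5, by decide, 0, by decide, 7, by decide, .inl c4⟩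
    · exact ⟨0, by decide, 9, by decide, 3, by decide, 5, by decide, .inr b2⟩
    · exact ⟨1, by decide, 9, by decide, 3, by decide, 7, by decide, .inr b1⟩
    · exact ⟨1, by decide, 6, by decide, 0, by decide, 8, by decide, .inl c3⟩
    · exact ⟨2, by decide, 6, by decide, 0, by decide, 9, by decide, .inl c2⟩
    · exact ⟨2, by decide, 8, by decide, 1, by decide, 9, by decide, .inl c1⟩
    · exact ⟨1, by decide, 5, by decide, 0, by decide, 7, by decide, .inl (hc _ _ _ _ c4)⟩
    · exact ⟨1, by decide, 6, by decide, 0, by decide, 8, by decide, .inl (hc _ _ _ _ c3)⟩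
    · exact ⟨5, by decide, 8, by decide, 6, by decide, 7, by decide, .inl a0⟩
    · exact ⟨0, by decide, 7, by decide, 2, by decide, 4, by decide, .inr (hc' _ _ _ _ b4)⟩
    · exact ⟨2, by decide, 6, by decide, 0, by decide, 9, by decide, .inl (hc _ _ _ _ c2)⟩
    · exact ⟨4, by decide, 9, by decide, 6, by decide, 7, by decide, .inr b0⟩
    · exact ⟨0, by decide, 8, by decide, 3, by decide, 4, by decide, .inr (hc' _ _ _ _ b3)⟩
    · exact ⟨0, by decide, 9, by decide, 3, by decide, 5, by decide, .inr (hc' _ _ _ _ b2)⟩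
    · exact ⟨5, by decide, 8, by decide, 4, by decide, 9, by decide, .inl c0⟩
    · exact ⟨1, by decide, 5, by decide, 2, by decide, 4, by decide, .inl (hc _ _ _ _ a4)⟩
    · exact ⟨2, by decide, 8, by decide, 1, by decide, 9, by decide, .inl (hc _ _ _ _ c1)⟩
    · exact ⟨5, by decide, 8, by decide, 4, by decide, 9, by decide, .inl (hc _ _ _ _ c0)⟩
    · exact ⟨1, by decide, 6, by decide, 3, by decide, 4, by decide, .inl (hc _ _ _ _ a3)⟩
    · exact ⟨1, by decide, 9, by decide, 3, by decide, 7, by decide, .inr (hc' _ _ _ _ b1)⟩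
    · exact ⟨4, by decide, 9, by decide, 6, by decide, 7, by decide, .inr (hc' _ _ _ _ b0)⟩
    · exact ⟨2, by decide, 6, by decide, 3, by decide, 5, by decide, .inl (hc _ _ _ _ a2)⟩
    · exact ⟨2, by decide, 8, by decide, 3, by decide, 7, by decide, .inl (hc _ _ _ _ a1)⟩
    · exact ⟨5, by decide, 8, by decide, 6, by decide, 7, by decide, .inl (hc _ _ _ _ a0)⟩
end core

section main
open Polynomial

lemma genericPfaffians_eq (k : Type*) [CommRing k] (τ : ℕ) {σ : Type*}
    (emb : Fin 10 × Fin τ → σ) : genericPfaffians k τ emb = pfaf (genericOmega k τ emb) := rfl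

lemma genericOmega_coeff (k : Type*) [CommRing k] (τ : ℕ) {σ : Type*}
    (emb : Fin 10 × Fin τ → σ) (i : Fin 10) (j : ℕ) (hj : j < τ) :
    (genericOmega k τ emb i).coeff j = MvPolynomial.X (emb (i, ⟨j, hj⟩)) := by
  simp only [genericOmega, finsetSum_coeff, coeff_C_mul, coeff_X_pow]
  rw [Finset.sum_eq_single ⟨j, hj⟩]
  · simp
  · intro b _ hb
    have : j ≠ (b : ℕ) := fun h => hb (Fin.ext h.symm)
    simp [this]
  · simp

lemma map_coeff_pfaffian {k : Type*} [CommRing k] {τ : ℕ} {σ : Type*}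
    (emb : Fin 10 × Fin τ → σ) {D : Type*} [CommRing D] (f : MvPolynomial σ k →+* D) (i : Fin 5) :
    X ^ τ ∣ pfaf (fun l => (genericOmega k τ emb l).map f) i ↔
      ∀ d < τ, f ((genericPfaffians k τ emb i).coeff d) = 0 := by
  rw [X_pow_dvd_iff]
  have : pfaf (fun l => (genericOmega k τ emb l).map f) i = (genericPfaffians k τ emb i).map f := by
    rw [genericPfaffians_eq]
    exact (map_pfaf (Polynomial.mapRingHom f) _ i).symm
  simp only [this, coeff_map]

lemma locus_le_ker_iff {k : Type*} [CommRing k] {τ : ℕ} {σ : Type*}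
    (emb : Fin 10 × Fin τ → σ) {D : Type*} [CommRing D] (f : MvPolynomial σ k →+* D) :
    pfaffianLocusIdeal k τ emb ≤ RingHom.ker f ↔
      ∀ i, X ^ τ ∣ pfaf (fun l => (genericOmega k τ emb l).map f) i := by
  simp only [map_coeff_pfaffian]
  rw [pfaffianLocusIdeal, Ideal.span_le]
  constructor
  · intro h i d hd
    exact h ⟨i, d, hd, rfl⟩
  · rintro h _ ⟨i, d, hd, rfl⟩
    exact h i d hd

lemma trdeg_quot (k : Type*) [Field k] (τ : ℕ) {D : Type*} [CommRing D] [IsDomain D] [Algebra k D]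
    (g : MvPolynomial (Fin (τ + 4) ⊕ Fin 10 × Fin τ) k →ₐ[k] D) (hg : Function.Surjective g)
    (hgI : pfaffianLocusIdeal k τ (Sum.inr : Fin 10 × Fin τ → Fin (τ + 4) ⊕ Fin 10 × Fin τ) ≤
      RingHom.ker g.toRingHom) :
    Algebra.trdeg k D ≤ (8 * τ + 4 : ℕ) := by
  classical
  let L := FractionRing D
  let f : MvPolynomial (Fin (τ + 4) ⊕ Fin 10 × Fin τ) k →+* L := (algebraMap D L).comp g.toRingHom
  have hf : pfaffianLocusIdeal k τ (Sum.inr : Fin 10 × Fin τ → Fin (τ + 4) ⊕ Fin 10 × Fin τ) ≤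
      RingHom.ker f := by
    intro x hx
    have : g.toRingHom x = 0 := hgI hx
    rw [RingHom.mem_ker, RingHom.comp_apply, this, map_zero]
  obtain ⟨S, hS, hS2⟩ := core (k := k) τ _ ((locus_le_ker_iff _ f).mp hf)
  refine trdeg_le_of_adjoin (L := L) (8 * τ + 4)
    (S ∪ Finset.univ.image (fun a : Fin (τ + 4) => f (MvPolynomial.X (Sum.inl a)))) ?_
    (Set.image g (Set.range MvPolynomial.X)) ?_ ?_
  · refine (Finset.card_union_le _ _).trans ?_
    have : (Finset.univ.image (fun a : Fin (τ + 4) => f (MvPolynomial.X (Sum.inl a)))).card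
        ≤ τ + 4 := Finset.card_image_le.trans (by simp)
    omega
  · rw [← AlgHom.map_adjoin, MvPolynomial.adjoin_range_X, Algebra.map_top]
    exact AlgHom.range_eq_top g |>.mpr hg
  · rintro _ ⟨_, ⟨a | ⟨i, j⟩, rfl⟩, rfl⟩
    · apply IntermediateField.subset_adjoin
      simp only [Finset.coe_union, Finset.coe_image, Finset.coe_univ, Set.image_univ]
      exact Or.inr ⟨a, rfl⟩
    · have h1 := hS2 i j j.2
      rw [coeff_map, genericOmega_coeff _ _ _ _ _ j.2] at h1
      exact IntermediateField.adjoin.mono k _ _ (by simp) h1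

lemma upper (k : Type*) [Field k] (τ : ℕ) :
    ringKrullDim (MvPolynomial (Fin (τ + 4) ⊕ Fin 10 × Fin τ) k ⧸
        pfaffianLocusIdeal k τ (Sum.inr : Fin 10 × Fin τ → Fin (τ + 4) ⊕ Fin 10 × Fin τ))
      ≤ (8 * τ + 4 : ℕ) := by
  refine dim_le (k := k) _ fun P hP => ?_
  refine trdeg_quot k τ ((Ideal.Quotient.mkₐ k P).comp (Ideal.Quotient.mkₐ k _))
    ((Ideal.Quotient.mkₐ_surjective k P).comp (Ideal.Quotient.mkₐ_surjective k _)) ?_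
  intro x hx
  have : Ideal.Quotient.mkₐ k (pfaffianLocusIdeal k τ
    (Sum.inr : Fin 10 × Fin τ → Fin (τ + 4) ⊕ Fin 10 × Fin τ)) x = 0 :=
    Ideal.Quotient.eq_zero_iff_mem.mpr hx
  change (Ideal.Quotient.mkₐ k P) (Ideal.Quotient.mkₐ k _ x) = 0
  rw [this, map_zero]

lemma pfaf_rest {D : Type*} [CommRing D] [IsDomain D] (n : ℕ) (w : Fin 10 → D[X])
    (h0 : (w 0).coeff 0 ≠ 0) (h2 : X ^ n ∣ pfaf w 2) (h3 : X ^ n ∣ pfaf w 3)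
    (h4 : X ^ n ∣ pfaf w 4) (i : Fin 5) : X ^ n ∣ pfaf w i := by
  have hX : ¬ X ∣ w 0 := by rwa [X_dvd_iff]
  have h : ∀ a b c, X ^ n ∣ a * pfaf w 2 - b * pfaf w 3 + c * pfaf w 4 := fun a b c =>
    dvd_add (dvd_sub (h2.mul_left a) (h3.mul_left b)) (h4.mul_left c)
  fin_cases i
  · refine prime_X.pow_dvd_of_dvd_mul_left n hX ?_
    convert! h (w 4) (w 5) (w 6) using 1
    simp [pfaf]; ring
  · refine prime_X.pow_dvd_of_dvd_mul_left n hX ?_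
    convert! h (w 1) (w 2) (w 3) using 1
    simp [pfaf]; ring
  · exact h2
  · exact h3
  · exact h4

lemma lower (k : Type*) [Field k] (τ : ℕ) (hτ : 1 ≤ τ) :
    ((8 * τ + 4 : ℕ) : WithBot ℕ∞) ≤ ringKrullDim (MvPolynomial (Fin (τ + 4) ⊕ Fin 10 × Fin τ) k ⧸
        pfaffianLocusIdeal k τ (Sum.inr : Fin 10 × Fin τ → Fin (τ + 4) ⊕ Fin 10 × Fin τ)) := by
  classical
  let emb : Fin 10 × Fin τ → Fin (τ + 4) ⊕ Fin 10 × Fin τ := Sum.inr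
  let pt : Fin (τ + 4) ⊕ Fin 10 × Fin τ → k := Pi.single (Sum.inr (0, ⟨0, hτ⟩)) 1
  let ev := MvPolynomial.eval pt
  have hsurj : Function.Surjective ev := fun c => ⟨MvPolynomial.C c, by simp [ev]⟩
  let m := RingHom.ker ev
  have hm : m.IsMaximal := RingHom.ker_isMaximal_of_surjective ev hsurj
  let s : Set (MvPolynomial (Fin (τ + 4) ⊕ Fin 10 × Fin τ) k) :=
    Set.range fun x : Fin 3 × Fin τ =>
      (genericPfaffians k τ emb ((![2, 3, 4] : Fin 3 → Fin 5) x.1)).coeff x.2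
  have hmI : pfaffianLocusIdeal k τ emb ≤ m := by
    rw [locus_le_ker_iff]
    have hw : ∀ l ≠ 0, (genericOmega k τ emb l).map ev = 0 := by
      intro l hl
      simp only [genericOmega, Polynomial.map_sum, Polynomial.map_mul, map_C]
      refine Finset.sum_eq_zero fun j _ => ?_
      have : ev (MvPolynomial.X (emb (l, j))) = 0 := by
        simp [ev, pt, emb, hl]
      simp [this]
    intro i
    fin_cases i <;> simp [pfaf, hw]
  have hs : s ⊆ m := by
    rintro _ ⟨x, rfl⟩
    exact hmI (Ideal.subset_span ⟨_, x.2, x.2.2, rfl⟩)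
  have key := dim_ge (pfaffianLocusIdeal k τ emb) s m hs (by
    intro q hq hsq hqm
    have hker : RingHom.ker (Ideal.Quotient.mk q) = q := Ideal.mk_ker
    rw [← hker, locus_le_ker_iff]
    have hh : ∀ i : Fin 3, X ^ τ ∣ pfaf (fun l => (genericOmega k τ emb l).map
        (Ideal.Quotient.mk q)) ((![2, 3, 4] : Fin 3 → Fin 5) i) := by
      intro i
      rw [map_coeff_pfaffian]
      intro d hd
      exact Ideal.Quotient.eq_zero_iff_mem.mpr (hsq ⟨(i, ⟨d, hd⟩), rfl⟩)
    refine pfaf_rest τ _ ?_ (hh 0) (hh 1) (hh 2)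
    rw [coeff_map, genericOmega_coeff _ _ _ _ _ hτ]
    intro h
    have h1 : ev (MvPolynomial.X (emb (0, ⟨0, hτ⟩))) = 0 :=
      hqm (Ideal.Quotient.eq_zero_iff_mem.mp h)
    simp [ev, pt, emb] at h1)
  have hcard : s.encard ≤ (3 * τ : ℕ) := by
    have h1 : s.encard ≤ ENat.card (Fin 3 × Fin τ) := by
      simp only [s]
      rw [← Set.image_univ, ← Set.encard_univ]
      exact Set.encard_image_le _ _
    simpa using h1
  have hht := max_height m hm
  have hN : Nat.card (Fin (τ + 4) ⊕ Fin 10 × Fin τ) = (8 * τ + 4) + 3 * τ := by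
    simp; ring
  rw [hN] at hht
  have h5 : ((((8 * τ + 4) + 3 * τ : ℕ) : ℕ∞) : WithBot ℕ∞) ≤
      ringKrullDim (MvPolynomial (Fin (τ + 4) ⊕ Fin 10 × Fin τ) k ⧸
        pfaffianLocusIdeal k τ emb) + (((3 * τ : ℕ) : ℕ∞) : WithBot ℕ∞) := by
    refine le_trans (WithBot.coe_le_coe.mpr hht) (key.trans ?_)
    gcongr
    exact WithBot.coe_le_coe.mpr hcard
  change (((8 * τ + 4 : ℕ) : ℕ∞) : WithBot ℕ∞) ≤
    ringKrullDim (MvPolynomial (Fin (τ + 4) ⊕ Fin 10 × Fin τ) k ⧸ pfaffianLocusIdeal k τ emb)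
  generalize ringKrullDim (MvPolynomial (Fin (τ + 4) ⊕ Fin 10 × Fin τ) k ⧸
        pfaffianLocusIdeal k τ emb) = d at h5
  induction d with
  | bot =>
    rw [WithBot.bot_add] at h5
    exact absurd h5 (not_le_of_gt (WithBot.bot_lt_coe _))
  | coe d =>
    rw [← WithBot.coe_add, WithBot.coe_le_coe] at h5
    rw [WithBot.coe_le_coe]
    rw [Nat.cast_add (8 * τ + 4) (3 * τ)] at h5
    exact (ENat.add_le_add_iff_right (ENat.natCast_ne_top _)).mp h5
end main

/-- Over an algebraically closed field `k` of characteristic zero and `τ ≥ 1`,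
with `𝒩 ⊆ R^{10} ≅ 𝔸^{10τ}` (`R = k[X]/(X^τ)`) the locus where the five `4×4` Pfaffians
vanish in `R`, the affine cone `𝒬ₙ = 𝔸^{τ+4} × 𝒩` has dimension `8τ + 4`.  Dimension is the
Krull dimension of the coordinate ring. -/
theorem pfaffian_cone_dimension_family_two
    (k : Type*) [Field k] [IsAlgClosed k] [CharZero k] (τ : ℕ) (hτ : 1 ≤ τ) :
    ringKrullDim (MvPolynomial (Fin (τ + 4) ⊕ Fin 10 × Fin τ) k ⧸
        pfaffianLocusIdeal k τ (Sum.inr : Fin 10 × Fin τ → Fin (τ + 4) ⊕ Fin 10 × Fin τ))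
      = (8 * τ + 4 : ℕ) := by
  exact le_antisymm (upper k τ) (lower k τ hτ)
end
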